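/- Let Γ̄ ∈ MCS_χ and Y := { Δ̄ ∈ MCS_χ | Δ̄ R_○ Γ̄ }. Then ⊢_CS (⋀Γ̄) → Ⓦ⋁{ ⋀Δ̄ | Δ̄ ∈ Y }, where the empty disjunction is ⊥, ⋀Γ̄ is the conjunction of all elements of Γ̄, and ⋁ is the disjunction over the finite set of such conjunctions. -/

import Mathlib

namespace TJL

/-- Justification terms: constants, variables, !t, t+t, t·t. -/
inductive JTerm : Type
  | const : ℕ → JTerm
  | var : ℕ → JTerm
  | bang : JTerm → JTerm
  | plus : JTerm → JTerm → JTerm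
  | app : JTerm → JTerm → JTerm

/-- Formulas of LPLTL^P with `h` agents. -/
inductive Formula (h : ℕ) : Type
  | atom : ℕ → Formula h
  | bot : Formula h
  | imp : Formula h → Formula h → Formula h
  | next : Formula h → Formula h
  | wprev : Formula h → Formula h
  | funtil : Formula h → Formula h → Formula h
  | fsince : Formula h → Formula h → Formula h
  | jbox : JTerm → Fin h → Formula h → Formula h

namespace Formula

variable {h : ℕ}

def neg (φ : Formula h) : Formula h := φ.imp .bot
def top : Formula h := neg .bot
def sprev (φ : Formula h) : Formula h := neg (wprev (neg φ))
def ev (φ : Formula h) : Formula h := funtil top φ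
def always (φ : Formula h) : Formula h := neg (ev (neg φ))
def once (φ : Formula h) : Formula h := fsince top φ
def halways (φ : Formula h) : Formula h := neg (once (neg φ))
def or' (φ ψ : Formula h) : Formula h := (neg φ).imp ψ
def and' (φ ψ : Formula h) : Formula h := neg (or' (neg φ) (neg ψ))
def iff' (φ ψ : Formula h) : Formula h := and' (φ.imp ψ) (ψ.imp φ)

end Formula

open Formula

/-- A boolean valuation respecting ⊥ and →. -/
def IsPropEval {h : ℕ} (v : Formula h → Bool) : Prop :=
  v .bot = false ∧ ∀ φ ψ : Formula h, v (φ.imp ψ) = (!(v φ) || v ψ)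

/-- Propositional tautologies. -/
def Tautology {h : ℕ} (φ : Formula h) : Prop :=
  ∀ v : Formula h → Bool, IsPropEval v → v φ = true

/-- The axioms of LPLTL^P. -/
inductive Ax {h : ℕ} : Formula h → Prop
  | taut (φ : Formula h) : Tautology φ → Ax φ
  | nextK (φ ψ : Formula h) : Ax ((Formula.next (φ.imp ψ)).imp ((Formula.next φ).imp (Formula.next ψ)))
  | boxK (φ ψ : Formula h) : Ax ((always (φ.imp ψ)).imp ((always φ).imp (always ψ)))
  | func (φ : Formula h) : Ax (iff' (Formula.next (neg φ)) (neg (Formula.next φ)))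
  | ind (φ : Formula h) : Ax ((always (φ.imp (Formula.next φ))).imp (φ.imp (always φ)))
  | until1 (φ ψ : Formula h) : Ax ((Formula.funtil φ ψ).imp (ev ψ))
  | until2 (φ ψ : Formula h) :
      Ax (iff' (Formula.funtil φ ψ) (or' ψ (and' φ (Formula.next (Formula.funtil φ ψ)))))
  | hboxK (φ ψ : Formula h) : Ax ((halways (φ.imp ψ)).imp ((halways φ).imp (halways ψ)))
  | wprevK (φ ψ : Formula h) :
      Ax ((Formula.wprev (φ.imp ψ)).imp ((Formula.wprev φ).imp (Formula.wprev ψ)))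
  | sw (φ : Formula h) : Ax ((sprev φ).imp (Formula.wprev φ))
  | fp (φ : Formula h) : Ax (φ.imp (Formula.next (sprev φ)))
  | pf (φ : Formula h) : Ax (φ.imp (Formula.wprev (Formula.next φ)))
  | initial : Ax (once (Formula.wprev (.bot : Formula h)))
  | hind (φ : Formula h) : Ax ((halways (φ.imp (Formula.wprev φ))).imp (φ.imp (halways φ)))
  | since1 (φ ψ : Formula h) : Ax ((Formula.fsince φ ψ).imp (once ψ))
  | since2 (φ ψ : Formula h) :
      Ax (iff' (Formula.fsince φ ψ) (or' ψ (and' φ (sprev (Formula.fsince φ ψ)))))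
  | japp (t s : JTerm) (i : Fin h) (φ ψ : Formula h) :
      Ax ((Formula.jbox t i (φ.imp ψ)).imp ((Formula.jbox s i φ).imp (Formula.jbox (.app t s) i ψ)))
  | jsum1 (t s : JTerm) (i : Fin h) (φ : Formula h) :
      Ax ((Formula.jbox t i φ).imp (Formula.jbox (.plus t s) i φ))
  | jsum2 (t s : JTerm) (i : Fin h) (φ : Formula h) :
      Ax ((Formula.jbox s i φ).imp (Formula.jbox (.plus t s) i φ))
  | jrefl (t : JTerm) (i : Fin h) (φ : Formula h) : Ax ((Formula.jbox t i φ).imp φ)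
  | jpos (t : JTerm) (i : Fin h) (φ : Formula h) :
      Ax ((Formula.jbox t i φ).imp (Formula.jbox (.bang t) i (Formula.jbox t i φ)))

/-- Formulas of the shape [c_n]_{i_n}⋯[c_1]_{i_1}φ with n ≥ 1 and φ an axiom instance. -/
inductive CSForm {h : ℕ} : Formula h → Prop
  | base (c : ℕ) (i : Fin h) (φ : Formula h) : Ax φ → CSForm (.jbox (.const c) i φ)
  | step (c : ℕ) (i : Fin h) (φ : Formula h) : CSForm φ → CSForm (.jbox (.const c) i φ)

/-- Downward-closed constant specifications. -/
def IsConstSpec {h : ℕ} (CS : Set (Formula h)) : Prop :=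
  (∀ φ ∈ CS, CSForm φ) ∧
  (∀ (c : ℕ) (i : Fin h) (φ : Formula h),
    Formula.jbox (.const c) i φ ∈ CS → CSForm φ → φ ∈ CS)

/-- Derivability in LPLTL^P_CS. -/
inductive Deriv {h : ℕ} (CS : Set (Formula h)) : Formula h → Prop
  | ax {φ : Formula h} : Ax φ → Deriv CS φ
  | cs {φ : Formula h} : φ ∈ CS → Deriv CS φ
  | mp {φ ψ : Formula h} : Deriv CS (φ.imp ψ) → Deriv CS φ → Deriv CS ψ
  | necNext {φ : Formula h} : Deriv CS φ → Deriv CS (.next φ)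
  | necWprev {φ : Formula h} : Deriv CS φ → Deriv CS (.wprev φ)
  | necBox {φ : Formula h} : Deriv CS φ → Deriv CS (always φ)
  | necHbox {φ : Formula h} : Deriv CS φ → Deriv CS (halways φ)

def conjList {h : ℕ} : List (Formula h) → Formula h
  | [] => top
  | φ :: l => and' φ (conjList l)

def disjList {h : ℕ} : List (Formula h) → Formula h
  | [] => .bot
  | φ :: l => or' φ (disjList l)

/-- Γ ⊢_CS φ : derivability from assumptions. -/
def DerivFrom {h : ℕ} (CS : Set (Formula h)) (Γ : Set (Formula h)) (φ : Formula h) : Prop :=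
  ∃ L : List (Formula h), (∀ ψ ∈ L, ψ ∈ Γ) ∧ Deriv CS ((conjList L).imp φ)

/-- CS-consistency. -/
def Consistent {h : ℕ} (CS : Set (Formula h)) (Γ : Set (Formula h)) : Prop :=
  ¬ DerivFrom CS Γ .bot

/-- Maximal CS-consistent sets. -/
def MaxCons {h : ℕ} (CS : Set (Formula h)) (Γ : Set (Formula h)) : Prop :=
  Consistent CS Γ ∧ ∀ Δ, Γ ⊆ Δ → Consistent CS Δ → Δ = Γ

/-- Subformulas. -/
def Subf {h : ℕ} : Formula h → Set (Formula h)
  | .atom P => {.atom P}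
  | .bot => {.bot}
  | .imp φ ψ => insert (.imp φ ψ) (Subf φ ∪ Subf ψ)
  | .next φ => insert (.next φ) (Subf φ)
  | .wprev φ => insert (.wprev φ) (Subf φ)
  | .funtil φ ψ => insert (.funtil φ ψ) (Subf φ ∪ Subf ψ)
  | .fsince φ ψ => insert (.fsince φ ψ) (Subf φ ∪ Subf ψ)
  | .jbox t i φ => insert (.jbox t i φ) (Subf φ)

/-- A_χ := Sub(χ) ∪ Sub(⊤ S Ⓦ⊥). -/
def Achi {h : ℕ} (χ : Formula h) : Set (Formula h) :=
  Subf χ ∪ Subf (Formula.fsince top (Formula.wprev .bot))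

/-- Sub⁺(χ) := A_χ ∪ {¬ψ | ψ ∈ A_χ}. -/
def SubPlus {h : ℕ} (χ : Formula h) : Set (Formula h) :=
  Achi χ ∪ (neg '' Achi χ)

/-- MCS_χ : the χ-maximal CS-consistent subsets of Sub⁺(χ). -/
def ChiMCS {h : ℕ} (CS : Set (Formula h)) (χ : Formula h) : Set (Set (Formula h)) :=
  {Γb | Γb ⊆ SubPlus χ ∧ Consistent CS Γb ∧
    ∀ Δ, Γb ⊆ Δ → Δ ⊆ SubPlus χ → Consistent CS Δ → Δ = Γb}

/-- The relation R_○ on MCS_χ, via representatives Γ, Δ ∈ MCS: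
    Γ̄ R_○ Δ̄ iff {○φ | φ ∈ Δ} ⊆ Γ. -/
def RNext {h : ℕ} (CS : Set (Formula h)) (χ : Formula h) (Γb Δb : Set (Formula h)) : Prop :=
  ∃ Γ Δ : Set (Formula h), MaxCons CS Γ ∧ MaxCons CS Δ ∧
    Γb = Γ ∩ SubPlus χ ∧ Δb = Δ ∩ SubPlus χ ∧
    ∀ φ ∈ Δ, Formula.next φ ∈ Γ

/-- γ is a conjunction of all elements of the finite set S (in some order). -/
def IsConj {h : ℕ} (S : Set (Formula h)) (γ : Formula h) : Prop :=
  ∃ L : List (Formula h), L.Nodup ∧ (∀ ψ, ψ ∈ L ↔ ψ ∈ S) ∧ γ = conjList L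

/-- Acceptable sequences of elements of MCS_χ. -/
def Acceptable {h : ℕ} (CS : Set (Formula h)) (χ : Formula h)
    (f : ℕ → Set (Formula h)) : Prop :=
  (∀ n, f n ∈ ChiMCS CS χ) ∧
  (∀ n, RNext CS χ (f n) (f (n + 1))) ∧
  (∀ n (φ ψ : Formula h), Formula.funtil φ ψ ∈ f n →
    ∃ m, n ≤ m ∧ ψ ∈ f m ∧ ∀ k, n ≤ k → k < m → φ ∈ f k) ∧
  Formula.wprev .bot ∈ f 0

end TJL

namespace TJL

open Formula

section

variable {h : ℕ} {CS : Set (Formula h)}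

theorem IsPropEval.imp_iff {v : Formula h → Bool} (hv : IsPropEval v) (φ ψ : Formula h) :
    v (φ.imp ψ) = true ↔ (v φ = true → v ψ = true) := by
  rw [hv.2]
  cases v φ <;> simp

theorem IsPropEval.neg_iff {v : Formula h → Bool} (hv : IsPropEval v) (φ : Formula h) :
    v (neg φ) = true ↔ ¬ v φ = true := by
  rw [neg, hv.imp_iff, hv.1]
  simp

theorem IsPropEval.or_iff {v : Formula h → Bool} (hv : IsPropEval v) (φ ψ : Formula h) :
    v (or' φ ψ) = true ↔ (v φ = true ∨ v ψ = true) := by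
  rw [or', hv.imp_iff, hv.neg_iff]
  tauto

theorem IsPropEval.and_iff {v : Formula h → Bool} (hv : IsPropEval v) (φ ψ : Formula h) :
    v (and' φ ψ) = true ↔ (v φ = true ∧ v ψ = true) := by
  rw [and', hv.neg_iff, hv.or_iff, hv.neg_iff, hv.neg_iff]
  tauto

theorem IsPropEval.conjList_iff {v : Formula h → Bool} (hv : IsPropEval v)
    (L : List (Formula h)) : v (conjList L) = true ↔ ∀ ψ ∈ L, v ψ = true := by
  induction L with
  | nil => simp [conjList, top, hv.neg_iff, hv.1]
  | cons a l ih => simp [conjList, hv.and_iff, ih]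

theorem IsPropEval.disjList_iff {v : Formula h → Bool} (hv : IsPropEval v)
    (L : List (Formula h)) : v (disjList L) = true ↔ ∃ ψ ∈ L, v ψ = true := by
  induction L with
  | nil => simp [disjList, hv.1]
  | cons a l ih => simp [disjList, hv.or_iff, ih]

theorem Deriv.of_taut {φ : Formula h}
    (H : ∀ v : Formula h → Bool, IsPropEval v → v φ = true) : Deriv CS φ :=
  .ax (.taut φ H)

/-- Closure of derivability under tautological consequence of one premise. -/
theorem Deriv.conseq {φ ψ : Formula h} (hφ : Deriv CS φ)
    (H : ∀ v : Formula h → Bool, IsPropEval v → v φ = true → v ψ = true) : Deriv CS ψ :=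
  .mp (.of_taut fun v hv => (hv.imp_iff _ _).2 (H v hv)) hφ

/-- Closure of derivability under tautological consequence of two premises. -/
theorem Deriv.conseq₂ {φ₁ φ₂ ψ : Formula h} (h₁ : Deriv CS φ₁) (h₂ : Deriv CS φ₂)
    (H : ∀ v : Formula h → Bool, IsPropEval v → v φ₁ = true → v φ₂ = true → v ψ = true) :
    Deriv CS ψ :=
  .mp (h₁.conseq fun v hv h1 => (hv.imp_iff _ _).2 (H v hv h1)) h₂

theorem Deriv.conjList_map_wprev {L : List (Formula h)} {φ : Formula h}
    (H : Deriv CS ((conjList L).imp φ)) :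
    Deriv CS ((conjList (L.map Formula.wprev)).imp (Formula.wprev φ)) := by
  induction L generalizing φ with
  | nil =>
    have hφ : Deriv CS φ := H.conseq fun v hv => by simp [hv.imp_iff, hv.conjList_iff]
    exact hφ.necWprev.conseq fun v hv => by simp +contextual [hv.imp_iff]
  | cons a l ih =>
    have h1 : Deriv CS ((conjList l).imp (a.imp φ)) := H.conseq fun v hv => by
      simp only [hv.imp_iff, conjList, hv.and_iff]
      tauto
    refine (ih h1).conseq₂ (.ax (.wprevK a φ)) fun v hv => ?_
    simp only [hv.imp_iff, conjList, List.map_cons, hv.and_iff]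
    tauto

theorem DerivFrom.mono {Γ Δ : Set (Formula h)} {φ : Formula h} (hΓ : Γ ⊆ Δ)
    (H : DerivFrom CS Γ φ) : DerivFrom CS Δ φ :=
  let ⟨L, hL, hd⟩ := H
  ⟨L, fun ψ hψ => hΓ (hL ψ hψ), hd⟩

theorem DerivFrom.of_mem {Γ : Set (Formula h)} {φ : Formula h} (hφ : φ ∈ Γ) :
    DerivFrom CS Γ φ :=
  ⟨[φ], by simpa using hφ, .of_taut fun v hv => by simp [hv.imp_iff, hv.conjList_iff]⟩

theorem DerivFrom.of_deriv {Γ : Set (Formula h)} {φ : Formula h} (H : Deriv CS φ) :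
    DerivFrom CS Γ φ :=
  ⟨[], by simp, H.conseq fun v hv => by simp +contextual [hv.imp_iff]⟩

theorem DerivFrom.mp {Γ : Set (Formula h)} {φ ψ : Formula h}
    (h₁ : DerivFrom CS Γ (φ.imp ψ)) (h₂ : DerivFrom CS Γ φ) : DerivFrom CS Γ ψ := by
  obtain ⟨L₁, hL₁, d₁⟩ := h₁
  obtain ⟨L₂, hL₂, d₂⟩ := h₂
  refine ⟨L₁ ++ L₂, fun χ hχ => (List.mem_append.1 hχ).elim (hL₁ χ) (hL₂ χ),
    d₁.conseq₂ d₂ fun v hv => ?_⟩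
  simp only [hv.imp_iff, hv.conjList_iff, List.mem_append]
  intro a b c
  exact a (fun χ hχ => c χ (.inl hχ)) (b fun χ hχ => c χ (.inr hχ))

/-- The deduction theorem for derivability from assumptions. -/
theorem DerivFrom.deduction {Γ : Set (Formula h)} {φ ψ : Formula h}
    (H : DerivFrom CS (insert φ Γ) ψ) : DerivFrom CS Γ (φ.imp ψ) := by
  classical
  obtain ⟨L, hL, d⟩ := H
  refine ⟨L.filter (· ≠ φ), fun χ hχ => ?_, d.conseq fun v hv => ?_⟩
  · obtain ⟨h1, h2⟩ := List.mem_filter.1 hχ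
    exact (hL χ h1).resolve_left (by simpa using h2)
  · simp only [hv.imp_iff, hv.conjList_iff, List.mem_filter]
    intro a b c
    refine a fun χ hχ => ?_
    by_cases e : χ = φ
    · exact e ▸ c
    · exact b χ ⟨hχ, by simpa using e⟩

theorem Consistent.mono {Γ Δ : Set (Formula h)} (hΓ : Γ ⊆ Δ) (H : Consistent CS Δ) :
    Consistent CS Γ :=
  fun d => H (d.mono hΓ)

theorem Consistent.neg_notMem {Γ : Set (Formula h)} {φ : Formula h} (H : Consistent CS Γ)
    (hφ : φ ∈ Γ) : neg φ ∉ Γ :=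
  fun hn => H ((DerivFrom.of_mem hn : DerivFrom CS Γ (φ.imp .bot)).mp (.of_mem hφ))

/-- Lindenbaum's lemma. -/
theorem Consistent.exists_maxCons {Γ : Set (Formula h)} (H : Consistent CS Γ) :
    ∃ Δ, Γ ⊆ Δ ∧ MaxCons CS Δ := by
  obtain ⟨Δ, hΓΔ, hΔ⟩ := zorn_subset_nonempty {Δ | Consistent CS Δ} (fun c hc hchain hne => by
    refine ⟨⋃₀ c, ?_, fun s hs => Set.subset_sUnion_of_mem hs⟩
    rintro ⟨L, hL, d⟩
    have key : ∃ s ∈ c, ∀ ψ ∈ L, ψ ∈ s := by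
      clear d
      induction L with
      | nil => exact ⟨hne.some, hne.some_mem, by simp⟩
      | cons a l ih =>
        obtain ⟨s, hs, hls⟩ := ih fun ψ hψ => hL ψ (List.mem_cons_of_mem _ hψ)
        obtain ⟨t, ht, hat⟩ := hL a List.mem_cons_self
        rcases hchain.total hs ht with hst | hts
        · exact ⟨t, ht, List.forall_mem_cons.2 ⟨hat, fun ψ hψ => hst (hls ψ hψ)⟩⟩
        · exact ⟨s, hs, List.forall_mem_cons.2 ⟨hts hat, hls⟩⟩
    obtain ⟨s, hs, hls⟩ := key
    exact hc hs ⟨L, hls, d⟩) Γ H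
  exact ⟨Δ, hΓΔ, hΔ.prop, fun Δ' hsub hcons => (hΔ.eq_of_subset hcons hsub).symm⟩

theorem MaxCons.mem_of_derivFrom {Γ : Set (Formula h)} {φ : Formula h} (H : MaxCons CS Γ)
    (hφ : DerivFrom CS Γ φ) : φ ∈ Γ := by
  rw [← H.2 (insert φ Γ) (Set.subset_insert _ _) fun d => H.1 (d.deduction.mp hφ)]
  exact Set.mem_insert _ _

theorem MaxCons.neg_mem {Γ : Set (Formula h)} {φ : Formula h} (H : MaxCons CS Γ)
    (hφ : φ ∉ Γ) : neg φ ∈ Γ := by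
  refine H.mem_of_derivFrom (DerivFrom.deduction ?_)
  by_contra hcons
  exact hφ (H.2 (insert φ Γ) (Set.subset_insert _ _) hcons ▸ Set.mem_insert _ _)

theorem MaxCons.inter_subPlus_mem_chiMCS {Γ : Set (Formula h)} (H : MaxCons CS Γ)
    (χ : Formula h) : Γ ∩ SubPlus χ ∈ ChiMCS CS χ := by
  refine ⟨Set.inter_subset_right, H.1.mono Set.inter_subset_left,
    fun Δ hsub hΔ hcons => (hsub.antisymm fun θ hθ => ⟨?_, hΔ hθ⟩).symm⟩
  by_contra hθΓ
  have hneg := H.neg_mem hθΓ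
  rcases hΔ hθ with hA | ⟨ψ, hψ, rfl⟩
  · exact hcons.neg_notMem hθ (hsub ⟨hneg, .inr ⟨θ, hA, rfl⟩⟩)
  · have hψΓ : ψ ∈ Γ := H.mem_of_derivFrom (DerivFrom.mp ?_ (.of_mem hneg))
    · exact hcons.neg_notMem (hsub ⟨hψΓ, .inl hψ⟩) hθ
    exact .of_deriv (.of_taut fun v hv => by simp [hv.imp_iff, hv.neg_iff])

/-- Every maximal consistent set omitting `Ⓦφ` has a temporal predecessor omitting `φ`. -/
theorem MaxCons.exists_predecessor {Γ : Set (Formula h)} {φ : Formula h} (H : MaxCons CS Γ)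
    (hφ : Formula.wprev φ ∉ Γ) :
    ∃ Δ, MaxCons CS Δ ∧ neg φ ∈ Δ ∧ ∀ ψ ∈ Γ, Formula.next ψ ∈ Δ := by
  have hcons : Consistent CS (insert (neg φ) {ψ | Formula.wprev ψ ∈ Γ}) := by
    intro d
    obtain ⟨L, hL, d⟩ := d.deduction
    have d' : Deriv CS ((conjList L).imp φ) := d.conseq fun v hv => by
      simp only [hv.imp_iff, hv.neg_iff, hv.1]
      tauto
    exact hφ (H.mem_of_derivFrom ⟨_, by simpa using hL, d'.conjList_map_wprev⟩)
  obtain ⟨Δ, hsub, hΔ⟩ := hcons.exists_maxCons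
  exact ⟨Δ, hΔ, hsub (Set.mem_insert _ _), fun ψ hψ => hsub (.inr
    (H.mem_of_derivFrom (DerivFrom.mp (.of_deriv (.ax (.pf ψ))) (.of_mem hψ))))⟩

end

end TJL

open TJL TJL.Formula in
/-- ⊢_CS (⋀Γ̄) → Ⓦ⋁{ ⋀Δ̄ | Δ̄ ∈ Y } where Y = { Δ̄ ∈ MCS_χ | Δ̄ R_○ Γ̄ }.
    The disjunction is rendered by any list `D` containing exactly the
    conjunctions of the members of Y (the empty disjunction being ⊥). -/
theorem deriv_wprev_disj_of_predecessors (h : ℕ) (hh : 1 ≤ h)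
    (CS : Set (Formula h)) (hCS : IsConstSpec CS) (χ : Formula h)
    (Γb : Set (Formula h)) (hΓb : Γb ∈ ChiMCS CS χ)
    (γ : Formula h) (hγ : IsConj Γb γ)
    (D : List (Formula h))
    (hD1 : ∀ δ ∈ D, ∃ Δb ∈ ChiMCS CS χ, RNext CS χ Δb Γb ∧ IsConj Δb δ)
    (hD2 : ∀ Δb ∈ ChiMCS CS χ, RNext CS χ Δb Γb → ∃ δ ∈ D, IsConj Δb δ) :
    Deriv CS (γ.imp (Formula.wprev (disjList D))) := by
  obtain ⟨L, -, hL, rfl⟩ := hγ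
  by_contra hnot
  have hcons : Consistent CS (insert (neg (Formula.wprev (disjList D))) Γb) := by
    intro d
    obtain ⟨L', hL', d⟩ := d.deduction
    refine hnot (d.conseq fun v hv => ?_)
    simp only [hv.imp_iff, hv.neg_iff, hv.1, hv.conjList_iff]
    intro a b
    have := a fun ψ hψ => b ψ ((hL ψ).2 (hL' ψ hψ))
    tauto
  obtain ⟨Γ, hsub, hΓ⟩ := hcons.exists_maxCons
  have hΓb' : Γb = Γ ∩ SubPlus χ :=
    (hΓb.2.2 (Γ ∩ SubPlus χ) (fun ψ hψ => ⟨hsub (.inr hψ), hΓb.1 hψ⟩) Set.inter_subset_right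
      (hΓ.1.mono Set.inter_subset_left)).symm
  have hW : Formula.wprev (disjList D) ∉ Γ :=
    fun hmem => hΓ.1.neg_notMem hmem (hsub (Set.mem_insert _ _))
  obtain ⟨Δ, hΔ, hneg, hnext⟩ := hΓ.exists_predecessor hW
  obtain ⟨δ, hδ, M, -, hM, rfl⟩ := hD2 _ (hΔ.inter_subPlus_mem_chiMCS χ)
    ⟨Δ, Γ, hΔ, hΓ, rfl, hΓb', hnext⟩
  have hD : DerivFrom CS Δ (disjList D) := by
    refine ⟨M, fun ψ hψ => ((hM ψ).1 hψ).1, .of_taut fun v hv => ?_⟩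
    exact (hv.imp_iff _ _).2 fun hv' => (hv.disjList_iff D).2 ⟨_, hδ, hv'⟩
  exact hΔ.1.neg_notMem (hΔ.mem_of_derivFrom hD) hneg
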